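/- Let m ≥ 2 be an integer and a an integer with 0 ≤ a ≤ m−2. For complex z with |z| < π/m, the function m sinh((a+1)z)/sinh(mz) is analytic (after removing the singularity at z = 0) and its Taylor expansion is m sinh((a+1)z)/sinh(mz) = Σ_{k=0}^{∞} E_k^{(m;a)} z^{2k}/(2k)!, where E_k^{(m;a)} = −( m (2m)^{2k} / (2k+1) ) ( B_{2k+1}((m−1−a)/(2m)) − B_{2k+1}((m+1+a)/(2m)) ) and B_j(x) is the j-th Bernoulli polynomial. -/

import Mathlib

open scoped Real BigOperators

/-- The generalized Euler number `E_k^{(m;a)} =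
−(m(2m)^{2k}/(2k+1)) (B_{2k+1}((m−1−a)/(2m)) − B_{2k+1}((m+1+a)/(2m)))`, where `B_j`
is the `j`-th Bernoulli polynomial (generating function `t e^{xt}/(e^t−1)`). -/
noncomputable def genEuler (m a k : ℕ) : ℚ :=
  -((m : ℚ) * (2 * (m : ℚ)) ^ (2 * k) / (2 * (k : ℚ) + 1)) *
    ((Polynomial.bernoulli (2 * k + 1)).eval (((m - 1 - a : ℕ) : ℚ) / (2 * m)) -
      (Polynomial.bernoulli (2 * k + 1)).eval (((m + 1 + a : ℕ) : ℚ) / (2 * m)))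

/-- The Bernoulli polynomials on `[0, 1]` satisfy `|Bₖ(x)| ≤ C k! / (2π) ^ k` for `k ≥ 2`. -/
theorem exists_abs_bernoulliFun_le :
    ∃ C : ℝ, ∀ k : ℕ, 2 ≤ k → ∀ x ∈ Set.Icc (0 : ℝ) 1,
      |bernoulliFun k x| / (k.factorial : ℝ) ≤ C / (2 * π) ^ k := by
  have hs : Summable fun n : ℤ => 1 / |(n : ℝ)| ^ 2 := by
    simpa using Real.summable_one_div_int_pow.mpr one_lt_two
  refine ⟨∑' n : ℤ, 1 / |(n : ℝ)| ^ 2, fun k hk x hx => ?_⟩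
  have h := hasSum_one_div_pow_mul_fourier_mul_bernoulliFun hk hx
  have hle : ∀ n : ℤ, ‖1 / (n : ℂ) ^ k * fourier n (x : UnitAddCircle)‖ ≤ 1 / |(n : ℝ)| ^ 2 := by
    intro n
    rcases eq_or_ne n 0 with rfl | hn
    · simp [show k ≠ 0 by lia]
    · have h1 : (1 : ℝ) ≤ |(n : ℝ)| := by exact_mod_cast Int.one_le_abs hn
      simp only [fourier_apply, norm_mul, norm_div, norm_one, norm_pow, Circle.norm_coe, mul_one,
        Complex.norm_intCast]
      gcongr
  have hb := tsum_of_norm_bounded hs.hasSum hle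
  rw [h.tsum_eq] at hb
  have hn : ‖-(2 * (π : ℂ) * Complex.I) ^ k / (k.factorial : ℂ) * (bernoulliFun k x : ℂ)‖ =
      |bernoulliFun k x| / (k.factorial : ℝ) * (2 * π) ^ k := by
    simp [abs_of_pos Real.pi_pos]
    ring
  rw [hn] at hb
  rwa [le_div_iff₀ (by positivity)]

theorem summable_norm_bernoulliFun_div_factorial_mul_pow {x : ℝ} (hx : x ∈ Set.Icc (0 : ℝ) 1)
    {t : ℂ} (ht : ‖t‖ < 2 * π) :
    Summable fun k : ℕ => ‖(bernoulliFun k x : ℂ) / (k.factorial : ℂ) * t ^ k‖ := by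
  obtain ⟨C, hC⟩ := exists_abs_bernoulliFun_le
  have hq : ‖t‖ / (2 * π) < 1 := by rwa [div_lt_one (by positivity)]
  have hg := (summable_geometric_of_lt_one (by positivity) hq).mul_left C
  refine Summable.of_norm_bounded_eventually_nat hg ?_
  filter_upwards [Filter.eventually_ge_atTop 2] with k hk
  have := mul_le_mul_of_nonneg_right (hC k hk x hx) (pow_nonneg (norm_nonneg t) k)
  calc _ = |bernoulliFun k x| / (k.factorial : ℝ) * ‖t‖ ^ k := by simp
    _ ≤ _ := this
    _ = _ := by rw [div_pow]; ring

theorem Complex.exp_ne_one_of_norm_lt_two_pi {t : ℂ} (h0 : t ≠ 0) (ht : ‖t‖ < 2 * π) :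
    Complex.exp t ≠ 1 := by
  intro h
  obtain ⟨n, rfl⟩ := Complex.exp_eq_one_iff.mp h
  have hn : n ≠ 0 := by rintro rfl; simp at h0
  have h1 : (1 : ℝ) ≤ |(n : ℝ)| := by exact_mod_cast Int.one_le_abs hn
  have h2 : ‖(n : ℂ) * (2 * π * Complex.I)‖ = |(n : ℝ)| * (2 * π) := by
    simp [abs_of_pos Real.pi_pos]
  rw [h2] at ht
  nlinarith [Real.pi_pos]

/-- The generating function of the Bernoulli polynomials on `[0, 1]`, as a convergent series. -/
theorem hasSum_bernoulliFun_div_factorial_mul_pow {x : ℝ} (hx : x ∈ Set.Icc (0 : ℝ) 1)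
    {t : ℂ} (h0 : t ≠ 0) (ht : ‖t‖ < 2 * π) :
    HasSum (fun k : ℕ => (bernoulliFun k x : ℂ) / (k.factorial : ℂ) * t ^ k)
      (t * Complex.exp (x * t) / (Complex.exp t - 1)) := by
  have hf := summable_norm_bernoulliFun_div_factorial_mul_pow hx ht
  have hexp (s : ℂ) : HasSum (fun n : ℕ => s ^ n / (n.factorial : ℂ)) (Complex.exp s) := by
    rw [Complex.exp_eq_exp_ℂ]
    exact NormedSpace.expSeries_div_hasSum_exp s
  have hg : HasSum (fun n : ℕ => PowerSeries.coeff n (PowerSeries.exp ℂ - 1) * t ^ n)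
      (Complex.exp t - 1) := by
    convert! (hexp t).sub (hasSum_ite_eq 0 (1 : ℂ)) using 2 with n
    rcases eq_or_ne n 0 with rfl | hn
    · simp
    · simp [PowerSeries.coeff_exp, PowerSeries.coeff_one, hn]
      ring
  have hr : HasSum (fun n : ℕ => PowerSeries.coeff n
      (PowerSeries.X * PowerSeries.rescale (x : ℂ) (PowerSeries.exp ℂ)) * t ^ n)
      (t * Complex.exp (x * t)) := by
    rw [← hasSum_nat_add_iff' 1]
    convert! (hexp (x * t)).mul_left t using 1
    · ext n
      simp [PowerSeries.coeff_succ_X_mul, PowerSeries.coeff_rescale, PowerSeries.coeff_exp]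
      ring
    · simp
  have hcoeff (n : ℕ) : PowerSeries.coeff n (PowerSeries.mk fun n =>
      Polynomial.aeval (x : ℂ) ((1 / n.factorial : ℚ) • Polynomial.bernoulli n)) =
      (bernoulliFun n x : ℂ) / (n.factorial : ℂ) := by
    have : Polynomial.aeval (x : ℂ) (Polynomial.bernoulli n) = (bernoulliFun n x : ℂ) := by
      rw [bernoulliFun, Polynomial.eval_map_algebraMap]
      exact Polynomial.aeval_algebraMap_apply ℂ x _
    rw [PowerSeries.coeff_mk, map_smul, this, Algebra.smul_def]
    simp
    ring
  have hprod := tsum_mul_tsum_eq_tsum_sum_antidiagonal_of_summable_norm hf hg.summable.norm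
  have hterm (n : ℕ) : ∑ kl ∈ Finset.HasAntidiagonal.antidiagonal n,
      ((bernoulliFun kl.1 x : ℂ) / (kl.1.factorial : ℂ) * t ^ kl.1) *
        (PowerSeries.coeff kl.2 (PowerSeries.exp ℂ - 1) * t ^ kl.2) =
      PowerSeries.coeff n
        (PowerSeries.X * PowerSeries.rescale (x : ℂ) (PowerSeries.exp ℂ)) * t ^ n := by
    rw [← Polynomial.bernoulli_generating_function, PowerSeries.coeff_mul, Finset.sum_mul]
    refine Finset.sum_congr rfl fun kl hkl => ?_
    rw [hcoeff, ← Finset.HasAntidiagonal.mem_antidiagonal.mp hkl, pow_add]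
    ring
  simp only [hterm, hg.tsum_eq, hr.tsum_eq] at hprod
  rw [← hprod, mul_div_cancel_right₀ _
    (sub_ne_zero.mpr (Complex.exp_ne_one_of_norm_lt_two_pi h0 ht))]
  exact hf.of_norm.hasSum

/-- The odd part in `x - 1 / 2` of the generating function of the Bernoulli polynomials. -/
theorem hasSum_bernoulliFun_odd {x : ℝ} (hx : x ∈ Set.Icc (0 : ℝ) 1)
    {t : ℂ} (h0 : t ≠ 0) (ht : ‖t‖ < 2 * π) :
    HasSum (fun k : ℕ => ((bernoulliFun (2 * k + 1) x - bernoulliFun (2 * k + 1) (1 - x) : ℝ) : ℂ) /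
        ((2 * k + 1).factorial : ℂ) * t ^ (2 * k + 1))
      (t * (Complex.exp (x * t) - Complex.exp ((1 - x) * t)) / (Complex.exp t - 1)) := by
  have hx' : 1 - x ∈ Set.Icc (0 : ℝ) 1 := ⟨by linarith [hx.2], by linarith [hx.1]⟩
  have h := (hasSum_bernoulliFun_div_factorial_mul_pow hx h0 ht).sub
    (hasSum_bernoulliFun_div_factorial_mul_pow hx' h0 ht)
  have hinj : Function.Injective fun k : ℕ => 2 * k + 1 := fun i j hij => by simpa using hij
  rw [← hinj.hasSum_iff] at h
  · convert! h using 1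
    · ext k
      simp only [Function.comp_apply]
      push_cast
      ring
    · push_cast
      ring
  · intro n hn
    have he : Even n := by
      by_contra ho
      obtain ⟨k, rfl⟩ := Nat.not_even_iff_odd.mp ho
      exact hn ⟨k, rfl⟩
    rw [bernoulliFun_eval_one_sub, he.neg_one_pow, one_mul, sub_self]

theorem ratCast_eval_bernoulli (n : ℕ) (q : ℚ) :
    (((Polynomial.bernoulli n).eval q : ℚ) : ℝ) = bernoulliFun n (q : ℝ) := by
  rw [bernoulliFun, ← eq_ratCast (algebraMap ℚ ℝ) q, Polynomial.eval_map_apply, eq_ratCast]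

theorem genEuler_zero {m a : ℕ} (hm : 2 ≤ m) (ha : a ≤ m - 2) : genEuler m a 0 = a + 1 := by
  obtain ⟨b, rfl⟩ : ∃ b, m = a + 2 + b := ⟨m - 2 - a, by lia⟩
  have h1 : a + 2 + b - 1 - a = b + 1 := by lia
  simp only [genEuler, h1]
  simp [Polynomial.bernoulli_one]
  field_simp
  ring

theorem Complex.sinh_eq_exp_mul (w : ℂ) :
    Complex.sinh w = Complex.exp (-w) * (Complex.exp (2 * w) - 1) / 2 := by
  rw [Complex.sinh, mul_sub, ← Complex.exp_add]
  ring_nf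

/-- for `m ≥ 2` and `0 ≤ a ≤ m−2`, the function
`m sinh((a+1)z)/sinh(mz)` (with the removable singularity at `z = 0` removed, where its
value is `a+1`) is, on the disc `|z| < π/m`, the sum of its Taylor series
`Σ_k E_k^{(m;a)} z^{2k}/(2k)!` with `E_k^{(m;a)}` as above. -/
theorem stmt14 (m a : ℕ) (hm : 2 ≤ m) (ha : a ≤ m - 2) (z : ℂ) (hz : ‖z‖ < π / m) :
    HasSum
      (fun k : ℕ => ((genEuler m a k : ℚ) : ℂ) * z ^ (2 * k) / ((2 * k).factorial : ℂ))
      (if z = 0 then ((a : ℂ) + 1)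
       else (m : ℂ) * Complex.sinh (((a : ℂ) + 1) * z) / Complex.sinh ((m : ℂ) * z)) := by
  rcases eq_or_ne z 0 with rfl | h0
  · rw [if_pos rfl]
    convert! hasSum_single (f := fun k : ℕ =>
      ((genEuler m a k : ℚ) : ℂ) * 0 ^ (2 * k) / ((2 * k).factorial : ℂ)) 0 ?_ using 1
    · simp [genEuler_zero hm ha]
    · intro k hk
      simp [hk]
  rw [if_neg h0]
  have hm0 : (0 : ℝ) < m := by exact_mod_cast (by lia : 0 < m)
  have hmC : (m : ℂ) ≠ 0 := by exact_mod_cast hm0.ne'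
  have hcast : ((m - 1 - a : ℕ) : ℝ) = m - 1 - a := by
    rw [Nat.cast_sub (by lia), Nat.cast_sub (by lia)]; simp
  obtain ⟨x, hxdef⟩ : ∃ x : ℝ, x = (m - 1 - a) / (2 * m) := ⟨_, rfl⟩
  have hx : x ∈ Set.Icc (0 : ℝ) 1 := by
    rw [hxdef, ← hcast]
    refine ⟨by positivity, ?_⟩
    rw [div_le_one (by positivity), hcast]
    have : (0 : ℝ) ≤ a := a.cast_nonneg
    linarith
  have hx1 : 1 - x = (m + 1 + a) / (2 * m) := by
    rw [hxdef]; field_simp; ring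
  have ht0 : 2 * (m : ℂ) * z ≠ 0 := by simp [hmC, h0]
  have ht : ‖2 * (m : ℂ) * z‖ < 2 * π := by
    rw [lt_div_iff₀ hm0] at hz
    simp only [norm_mul, Complex.norm_ofNat, Complex.norm_natCast]
    linarith
  have hG (k : ℕ) : ((genEuler m a k : ℚ) : ℂ) = -((m : ℂ) * (2 * m) ^ (2 * k) / (2 * k + 1)) *
      ((bernoulliFun (2 * k + 1) x - bernoulliFun (2 * k + 1) (1 - x) : ℝ) : ℂ) := by
    have h : ((genEuler m a k : ℚ) : ℝ) = -((m : ℝ) * (2 * m) ^ (2 * k) / (2 * k + 1)) *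
        (bernoulliFun (2 * k + 1) x - bernoulliFun (2 * k + 1) (1 - x)) := by
      simp only [genEuler, Rat.cast_mul, Rat.cast_neg, Rat.cast_sub, ratCast_eval_bernoulli]
      rw [hx1, hxdef, ← hcast]
      push_cast
      rfl
    rw [← Complex.ofReal_ratCast, h]
    push_cast
    rfl
  convert! (hasSum_bernoulliFun_odd hx ht0 ht).mul_left (-1 / (2 * z)) using 1
  · ext k
    have hk : (2 * (k : ℂ) + 1) ≠ 0 := by exact_mod_cast (2 * k).succ_ne_zero
    have hf : ((2 * k).factorial : ℂ) ≠ 0 := by exact_mod_cast (2 * k).factorial_ne_zero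
    rw [hG, Nat.factorial_succ, pow_succ]
    push_cast
    field_simp
    rw [mul_pow, mul_pow]
    ring
  · have e1 : (x : ℂ) * (2 * m * z) = m * z + -((a + 1) * z) := by
      rw [hxdef]; push_cast; field_simp; ring
    have e2 : (1 - (x : ℂ)) * (2 * m * z) = m * z + (a + 1) * z := by
      rw [sub_mul, e1]; ring
    rw [e1, e2, Complex.sinh_eq_exp_mul (m * z), Complex.exp_add, Complex.exp_add,
      ← mul_assoc 2 (m : ℂ) z, Complex.exp_neg (m * z), Complex.sinh]
    have hne := Complex.exp_ne_zero (m * z)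
    field_simp
    ring
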